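/- Let V be a real vector space of finite dimension m ≥ 2, S > 0, c ≥ 0, and let (B_s)_{s ∈ [0,S]} be a family of positive-definite symmetric bilinear forms on V such that for every v ∈ V the function s ↦ B_s(v, v) is differentiable on [0, S] with |∂_s B_s(v, v)| ≤ c·B_s(v, v) for all s and v. Then for every s ∈ [0, S], every eigenvalue λ of the endomorphism A_{B_0,B_s} (defined by B_0(A_{B_0,B_s} v, w) = B_s(v, w)) satisfies |log λ| ≤ c·s, and hence δ_{B_s,B_0} := 2·sinh((m/4)·max_{λ ∈ spec(A_{B_0,B_s})} |log λ|) ≤ 2·sinh((m/4)·c·S). -/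

import Mathlib

/-- The quantity `max_{λ ∈ spec(A)} |log λ|` for an endomorphism `A`, expressed as the
supremum of `|log μ|` over the eigenvalues `μ` of `A`. -/
noncomputable def maxAbsLogSpec {V : Type*} [AddCommGroup V] [Module ℝ V]
    (A : V →ₗ[ℝ] V) : ℝ :=
  sSup {t : ℝ | ∃ μ : ℝ, Module.End.HasEigenvalue A μ ∧ t = |Real.log μ|}

/-- Let `V` be a real vector space of finite dimension `m ≥ 2`, `S > 0`,
`c ≥ 0`, and let `(B_s)_{s ∈ [0,S]}` be a family of positive-definite symmetric bilinear
forms on `V` such that for every `v` the function `s ↦ B_s(v,v)` is differentiable on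
`[0,S]` (with derivative `B' s v`) and `|∂_s B_s(v,v)| ≤ c·B_s(v,v)`. Then for every
`s ∈ [0,S]`, every eigenvalue `λ` of the endomorphism `A = A_{B_0,B_s}` (defined by
`B_0 (A v) w = B_s v w`) satisfies `|log λ| ≤ c·s`, and hence
`δ_{B_s,B_0} = 2·sinh((m/4)·max_{λ ∈ spec(A)} |log λ|) ≤ 2·sinh((m/4)·c·S)`. -/
theorem statement9
    {V : Type*} [AddCommGroup V] [Module ℝ V] [FiniteDimensional ℝ V]
    {m : ℕ} (hm : 2 ≤ m) (hdim : Module.finrank ℝ V = m)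
    (S c : ℝ) (hS : 0 < S) (hc : 0 ≤ c)
    (B : ℝ → V →ₗ[ℝ] V →ₗ[ℝ] ℝ)
    (hsymm : ∀ s ∈ Set.Icc (0 : ℝ) S, ∀ v w : V, B s v w = B s w v)
    (hpos : ∀ s ∈ Set.Icc (0 : ℝ) S, ∀ v : V, v ≠ 0 → 0 < B s v v)
    (B' : ℝ → V → ℝ)
    (hderiv : ∀ v : V, ∀ s ∈ Set.Icc (0 : ℝ) S,
      HasDerivWithinAt (fun t : ℝ => B t v v) (B' s v) (Set.Icc (0 : ℝ) S) s)
    (hbound : ∀ v : V, ∀ s ∈ Set.Icc (0 : ℝ) S, |B' s v| ≤ c * B s v v) :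
    ∀ s ∈ Set.Icc (0 : ℝ) S, ∀ A : V →ₗ[ℝ] V,
      (∀ v w : V, B 0 (A v) w = B s v w) →
      (∀ μ : ℝ, Module.End.HasEigenvalue A μ → |Real.log μ| ≤ c * s) ∧
      2 * Real.sinh ((m / 4 : ℝ) * maxAbsLogSpec A)
        ≤ 2 * Real.sinh ((m / 4 : ℝ) * c * S) := by
  intro s hs A hA
  have h0 : (0 : ℝ) ∈ Set.Icc (0 : ℝ) S := ⟨le_rfl, hS.le⟩
  have key : ∀ μ : ℝ, Module.End.HasEigenvalue A μ → |Real.log μ| ≤ c * s := by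
    intro μ hμ
    obtain ⟨v, hv⟩ := hμ.exists_hasEigenvector
    have hv0 : v ≠ 0 := hv.2
    have hAv : A v = μ • v := hv.apply_eq_smul
    have h1 : μ * B 0 v v = B s v v := by
      have := hA v v
      rw [hAv] at this
      simpa using this
    have p0 := hpos 0 h0 v hv0
    have ps := hpos s hs v hv0
    have hμe : μ = B s v v / B 0 v v := by
      rw [← h1]; field_simp
    have hlog : Real.log μ = Real.log (B s v v) - Real.log (B 0 v v) := by
      rw [hμe, Real.log_div ps.ne' p0.ne']
    have hmv := Convex.norm_image_sub_le_of_norm_hasDerivWithin_le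
      (f := fun t => Real.log (B t v v)) (f' := fun t => B' t v / B t v v) (C := c)
      (s := Set.Icc (0 : ℝ) S) (x := 0) (y := s)
      (fun t ht => (hderiv v t ht).log (hpos t ht v hv0).ne')
      (fun t ht => by
        have pt := hpos t ht v hv0
        rw [Real.norm_eq_abs, abs_div, abs_of_pos pt, div_le_iff₀ pt]
        exact hbound v t ht)
      (convex_Icc 0 S) h0 hs
    rw [hlog]
    simpa [Real.norm_eq_abs, abs_of_nonneg hs.1] using hmv
  refine ⟨key, ?_⟩
  have hsup : maxAbsLogSpec A ≤ c * S := by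
    apply Real.sSup_le
    · rintro t ⟨μ, hμ, rfl⟩
      exact (key μ hμ).trans (mul_le_mul_of_nonneg_left hs.2 hc)
    · positivity
  have : (m / 4 : ℝ) * maxAbsLogSpec A ≤ (m / 4 : ℝ) * c * S := by
    rw [mul_assoc]
    exact mul_le_mul_of_nonneg_left hsup (by positivity)
  have := Real.sinh_le_sinh.mpr this
  linarith
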